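/- Let ℛ = (|ℛ|, ·) be a partial applicative structure such that Σ[ℛ] is posetal. Then Σ[ℛ] is bounded-posetal: there exist ⊥, ⊤ ∈ 𝒫(|ℛ|) (namely ⊥ = ∅ and ⊤ = |ℛ|) and 𝐛, 𝐭 ∈ |ℛ| such that 𝐛 ∈ (⊥ ⇒ A) and 𝐭 ∈ (A ⇒ ⊤) for every A ⊆ |ℛ|. -/

import Mathlib

/-- The entailment relation `φ ⊢_I ψ` induced by a PR-structure `(P, R, ρ)`. -/
def PREntails {P R : Type} (ρ : P → P → Set R) {I : Type} (φ ψ : I → P) : Prop :=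
  (⋂ i : I, ρ (φ i) (ψ i)).Nonempty

/-- For a partial applicative structure `(R, ·)` (modelled by `app : R → R → Option R`),
the realizability implication `A ⇒ B` of subsets `A, B ⊆ R`. -/
def Imp {R : Type} (app : R → R → Option R) (A B : Set R) : Set R :=
  {r : R | ∀ a ∈ A, ∃ b ∈ B, app r a = some b}

/-- If `ℛ` is a partial applicative structure such that `Σ[ℛ]` is
posetal, then `Σ[ℛ]` is bounded-posetal: with `⊥ = ∅` and `⊤ = |ℛ|`, there exist
`𝐛, 𝐭 ∈ |ℛ|` such that `𝐛 ∈ (⊥ ⇒ A)` and `𝐭 ∈ (A ⇒ ⊤)` for every `A ⊆ |ℛ|`. -/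
theorem stmt_18 {R : Type} [Nonempty R] (app : R → R → Option R)
    (hpos : ∀ I : Type, Reflexive (fun φ ψ : I → Set R => PREntails (Imp app) φ ψ) ∧
        Transitive (fun φ ψ : I → Set R => PREntails (Imp app) φ ψ) ∧
        AntiSymmetric (fun φ ψ : I → Set R => PREntails (Imp app) φ ψ)) :
    ∃ b t : R, (∀ A : Set R, b ∈ Imp app (∅ : Set R) A) ∧
      (∀ A : Set R, t ∈ Imp app A (Set.univ : Set R)) := by
  obtain ⟨t, ht⟩ := (hpos Unit).1 (fun _ => Set.univ)
  have ht' : t ∈ Imp app Set.univ Set.univ := Set.mem_iInter.1 ht ()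
  exact ⟨t, t, fun _ _ ha => ha.elim, fun _ a _ => ht' a (Set.mem_univ a)⟩
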